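/- arXiv:2408.12019 — 2 statements merged into one kernel-verified Lean document; each statement's English description precedes it below -/
import Mathlib

section
/- Let p be a prime and 2 ≤ ℓ ≤ n. Then, in the real numbers, (p^n−1)/(p^{ℓ−1}−1) ≤ limsup_{k→∞} Θ_n^{(k,ℓ)}/k ≤ p^n − 1, where the limsup is taken over integers k → ∞. -/
open Finset

/-- A finite set of nonzero vectors of `ℚ_p^n` is orthogonal if every linear
combination of its elements realizes the equality case of the ultrametric
inequality (here `ℚ_p^n` carries the sup norm, and we compare nonnegative-real
valued norms so that the empty supremum makes sense). -/
def OrthSet (p : ℕ) [Fact p.Prime] {n : ℕ} (F : Finset (Fin n → ℚ_[p])) : Prop :=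
  ∀ lam : (Fin n → ℚ_[p]) → ℚ_[p],
    ‖∑ u ∈ F, lam u • u‖₊ = F.sup fun u => ‖lam u • u‖₊

/-- A finite set `S ⊆ ℚ_p^n \ {0}` is `(k,ℓ)`-orthogonal if every `E ⊆ S` of size
`k` contains an orthogonal subset of size `ℓ`. -/
def OrthKL (p : ℕ) [Fact p.Prime] {n : ℕ} (k ℓ : ℕ)
    (S : Finset (Fin n → ℚ_[p])) : Prop :=
  (0 : Fin n → ℚ_[p]) ∉ S ∧
    ∀ E ⊆ S, E.card = k → ∃ F ⊆ E, F.card = ℓ ∧ OrthSet p F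

/-- `Θ_n^{(k,ℓ)}`: the maximum size of a finite `(k,ℓ)`-orthogonal subset of
`ℚ_p^n \ {0}`. -/
noncomputable def Theta (p : ℕ) [Fact p.Prime] (n k ℓ : ℕ) : ℕ :=
  sSup {m | ∃ S : Finset (Fin n → ℚ_[p]), OrthKL p k ℓ S ∧ S.card = m}

section Reduction

variable {p : ℕ} [Fact p.Prime]

theorem PadicInt.toZMod_eq_zero_iff_norm_lt_one (z : ℤ_[p]) :
    PadicInt.toZMod z = 0 ↔ ‖z‖ < 1 := by
  rw [← RingHom.mem_ker, PadicInt.ker_toZMod, IsLocalRing.mem_maximalIdeal, PadicInt.mem_nonunits]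

/-- Reduction modulo `p` of a `p`-adic number, with the value `0` outside `ℤ_[p]`. -/
noncomputable def Padic.residue (x : ℚ_[p]) : ZMod p :=
  if h : ‖x‖ ≤ 1 then PadicInt.toZMod ⟨x, h⟩ else 0

theorem Padic.residue_coe (z : ℤ_[p]) : Padic.residue (z : ℚ_[p]) = PadicInt.toZMod z := by
  rw [Padic.residue, dif_pos (by simpa using z.norm_le_one)]
  rfl

theorem Padic.residue_natCast (m : ℕ) : Padic.residue (m : ℚ_[p]) = (m : ZMod p) := by
  have := Padic.residue_coe (p := p) (m : ℤ_[p])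
  simpa using this

theorem Padic.norm_sub_lt_one_of_residue_eq {x y : ℚ_[p]} (hx : ‖x‖ ≤ 1) (hy : ‖y‖ ≤ 1)
    (h : Padic.residue x = Padic.residue y) : ‖x - y‖ < 1 := by
  obtain ⟨x, rfl⟩ : ∃ z : ℤ_[p], (z : ℚ_[p]) = x := ⟨⟨x, hx⟩, rfl⟩
  obtain ⟨y, rfl⟩ : ∃ z : ℤ_[p], (z : ℚ_[p]) = y := ⟨⟨y, hy⟩, rfl⟩
  rw [Padic.residue_coe, Padic.residue_coe, ← sub_eq_zero, ← map_sub,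
    PadicInt.toZMod_eq_zero_iff_norm_lt_one, PadicInt.norm_def,
    PadicInt.coe_sub] at h
  exact h

variable {n : ℕ}

/-- Coordinatewise reduction modulo `p` of a vector of `ℚ_p^n`. -/
noncomputable def residueVec (u : Fin n → ℚ_[p]) : Fin n → ZMod p := fun i => Padic.residue (u i)

theorem residueVec_ne_zero {u : Fin n → ℚ_[p]} (hu : ‖u‖ = 1) : residueVec u ≠ 0 := by
  intro h
  have : ‖u‖ < 1 := by
    rw [pi_norm_lt_iff one_pos]
    intro i
    have hi : ‖u i‖ ≤ 1 := hu ▸ norm_le_pi_norm u i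
    have h0 : Padic.residue (u i) = Padic.residue (0 : ℚ_[p]) := by
      have := Padic.residue_natCast (p := p) 0
      simp only [Nat.cast_zero] at this
      rw [this]
      exact congrFun h i
    simpa using Padic.norm_sub_lt_one_of_residue_eq hi (by simp) h0
  exact absurd hu this.ne

theorem exists_norm_smul_eq_one {u : Fin n → ℚ_[p]} (hu : u ≠ 0) : ∃ c : ℚ_[p], ‖c • u‖ = 1 := by
  have hn : Nonempty (Fin n) := by
    by_contra h
    rw [not_nonempty_iff] at h
    exact hu (Subsingleton.elim _ _)
  obtain ⟨i, -, hi⟩ := Finset.exists_max_image univ (fun i => ‖u i‖) univ_nonempty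
  have hni : ‖u‖ = ‖u i‖ :=
    le_antisymm ((pi_norm_le_iff_of_nonneg (norm_nonneg _)).2 fun j => hi j (mem_univ j))
      (norm_le_pi_norm u i)
  refine ⟨(u i)⁻¹, ?_⟩
  rw [norm_smul, norm_inv, ← hni, inv_mul_cancel₀ (norm_ne_zero_iff.2 hu)]

/-- Integral vectors with linearly independent reductions are orthogonal. -/
theorem orthSet_of_linearIndepOn {F : Finset (Fin n → ℚ_[p])} (hF : ∀ u ∈ F, ‖u‖ ≤ 1)
    (hli : LinearIndepOn (ZMod p) residueVec (F : Set (Fin n → ℚ_[p]))) : OrthSet p F := by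
  intro lam
  refine le_antisymm (Finset.nnnorm_sum_le_sup_nnnorm _ _) (Finset.sup_le fun u hu => ?_)
  obtain ⟨v, hv, hmax⟩ := Finset.exists_max_image F (fun u => ‖lam u‖) ⟨u, hu⟩
  suffices h : ‖lam v‖ ≤ ‖∑ u ∈ F, lam u • u‖ by
    rw [← NNReal.coe_le_coe, coe_nnnorm, coe_nnnorm, norm_smul]
    calc ‖lam u‖ * ‖u‖ ≤ ‖lam u‖ * 1 := by gcongr; exact hF u hu
      _ ≤ ‖lam v‖ := by rw [mul_one]; exact hmax u hu
      _ ≤ _ := h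
  by_contra! hlt
  have hpos : 0 < ‖lam v‖ := (norm_nonneg _).trans_lt hlt
  have hv0 : lam v ≠ 0 := norm_pos_iff.1 hpos
  have hc (u) : ∃ c : ℤ_[p], u ∈ F → (c : ℚ_[p]) = lam u / lam v := by
    by_cases hu : u ∈ F
    · exact ⟨⟨lam u / lam v, by rw [norm_div, div_le_one hpos]; exact hmax u hu⟩, fun _ => rfl⟩
    · exact ⟨0, fun h => absurd h hu⟩
  have hg (u : Fin n → ℚ_[p]) (i) : ∃ c : ℤ_[p], u ∈ F → (c : ℚ_[p]) = u i := by
    by_cases hu : u ∈ F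
    · exact ⟨⟨u i, (norm_le_pi_norm u i).trans (hF u hu)⟩, fun _ => rfl⟩
    · exact ⟨0, fun h => absurd h hu⟩
  choose c hc using hc
  choose g hg using hg
  have hsum : ∑ u ∈ F, PadicInt.toZMod (c u) • residueVec u = 0 := by
    ext i
    have h1 : ‖∑ u ∈ F, c u * g u i‖ < 1 := by
      have h2 : ((∑ u ∈ F, c u * g u i : ℤ_[p]) : ℚ_[p]) =
          (∑ u ∈ F, lam u • u) i / lam v := by
        rw [PadicInt.coe_sum, Finset.sum_apply, Finset.sum_div]
        refine Finset.sum_congr rfl fun u hu => ?_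
        rw [PadicInt.coe_mul, hc u hu, hg u i hu, Pi.smul_apply, smul_eq_mul]
        ring
      rw [PadicInt.norm_def, h2, norm_div, div_lt_one hpos]
      exact (norm_le_pi_norm _ i).trans_lt hlt
    rw [← PadicInt.toZMod_eq_zero_iff_norm_lt_one, map_sum] at h1
    rw [Finset.sum_apply, Pi.zero_apply, ← h1]
    refine Finset.sum_congr rfl fun u hu => ?_
    rw [Pi.smul_apply, smul_eq_mul, map_mul, residueVec, ← hg u i hu, Padic.residue_coe]
  have hzero := linearIndepOn_finset_iff.1 hli _ hsum v hv
  have hone : c v = 1 := by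
    apply Subtype.coe_injective
    simp [hc v hv, div_self hv0]
  simp [hone] at hzero

/-- Two distinct members of an orthogonal set have no normalizations with the same reduction. -/
theorem OrthSet.residueVec_ne {F : Finset (Fin n → ℚ_[p])} (hF : OrthSet p F)
    {u v : Fin n → ℚ_[p]} (hu : u ∈ F) (hv : v ∈ F) (huv : u ≠ v) {a b : ℚ_[p]}
    (ha : ‖a • u‖ = 1) (hb : ‖b • v‖ = 1) : residueVec (a • u) ≠ residueVec (b • v) := by
  classical
  intro h
  have hlt : ‖a • u - b • v‖ < 1 := by
    rw [pi_norm_lt_iff one_pos]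
    intro i
    exact Padic.norm_sub_lt_one_of_residue_eq (ha ▸ norm_le_pi_norm (a • u) i)
      (hb ▸ norm_le_pi_norm (b • v) i) (congrFun h i)
  set lam : (Fin n → ℚ_[p]) → ℚ_[p] := fun x => if x = u then a else if x = v then -b else 0
    with hlam
  have hsum : ∑ x ∈ F, lam x • x = a • u - b • v := by
    rw [← Finset.sum_subset (s₁ := {u, v}), Finset.sum_pair huv]
    · simp [hlam, huv.symm, sub_eq_add_neg]
    · simp [Finset.insert_subset_iff, hu, hv]
    · intro x _ hx
      simp only [mem_insert, mem_singleton, not_or] at hx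
      simp [hlam, hx.1, hx.2]
  have hle : ‖lam u • u‖₊ ≤ ‖∑ x ∈ F, lam x • x‖₊ := by
    rw [hF lam]
    exact Finset.le_sup (f := fun u => ‖lam u • u‖₊) hu
  rw [hsum, ← NNReal.coe_le_coe, coe_nnnorm, coe_nnnorm] at hle
  simp only [hlam, if_true, ha] at hle
  exact absurd hlt hle.not_gt

theorem card_filter_ne_zero_zmod (p n : ℕ) [Fact p.Prime] :
    #{w : Fin n → ZMod p | w ≠ 0} = p ^ n - 1 := by
  rw [Finset.filter_ne', Finset.card_erase_of_mem (mem_univ _), Finset.card_univ]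
  simp [ZMod.card]

theorem OrthKL.card_le {k ℓ : ℕ} (hℓ : 2 ≤ ℓ) {S : Finset (Fin n → ℚ_[p])}
    (hS : OrthKL p k ℓ S) : #S ≤ k * (p ^ n - 1) := by
  classical
  have hscale (u : Fin n → ℚ_[p]) : ∃ c : ℚ_[p], u ≠ 0 → ‖c • u‖ = 1 := by
    by_cases hu : u = 0
    · exact ⟨0, fun h => absurd hu h⟩
    · exact (exists_norm_smul_eq_one hu).imp fun c hc _ => hc
  choose c hc using hscale
  have hne {u} (hu : u ∈ S) : u ≠ 0 := fun h => hS.1 (h ▸ hu)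
  refine (Finset.card_le_mul_card_image (f := fun u => residueVec (c u • u)) S k ?_).trans ?_
  · intro w _
    by_contra! hcard
    obtain ⟨E, hE, hEk⟩ := Finset.exists_subset_card_eq hcard.le
    obtain ⟨F, hFE, hFℓ, hF⟩ := hS.2 E (hE.trans (Finset.filter_subset _ _)) hEk
    obtain ⟨u, hu, v, hv, huv⟩ := Finset.one_lt_card.1 (show 1 < #F by omega)
    have hu' := Finset.mem_filter.1 (hE (hFE hu))
    have hv' := Finset.mem_filter.1 (hE (hFE hv))
    exact hF.residueVec_ne hu hv huv (hc u (hne hu'.1)) (hc v (hne hv'.1))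
      (hu'.2.trans hv'.2.symm)
  · rw [← card_filter_ne_zero_zmod p n]
    refine Nat.mul_le_mul_left _ (Finset.card_le_card fun w hw => ?_)
    obtain ⟨u, hu, rfl⟩ := Finset.mem_image.1 hw
    simpa using residueVec_ne_zero (hc u (hne hu))

theorem Theta_le {k ℓ : ℕ} (hℓ : 2 ≤ ℓ) : Theta p n k ℓ ≤ k * (p ^ n - 1) := by
  refine csSup_le' ?_
  rintro _ ⟨S, hS, rfl⟩
  exact hS.card_le hℓ

theorem OrthKL.card_le_Theta {k ℓ : ℕ} (hℓ : 2 ≤ ℓ) {S : Finset (Fin n → ℚ_[p])}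
    (hS : OrthKL p k ℓ S) : #S ≤ Theta p n k ℓ := by
  refine le_csSup ⟨k * (p ^ n - 1), ?_⟩ ⟨S, hS, rfl⟩
  rintro _ ⟨T, hT, rfl⟩
  exact hT.card_le hℓ

/-- The `j`-th standard natural-number lift of a vector of `𝔽_p^n`. -/
noncomputable def shiftedLift (x : (Fin n → ZMod p) × ℕ) : Fin n → ℚ_[p] :=
  fun i => (((x.1 i).val + p * x.2 : ℕ) : ℚ_[p])

theorem residueVec_shiftedLift (x : (Fin n → ZMod p) × ℕ) :
    residueVec (shiftedLift x) = x.1 := by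
  ext i
  simp [residueVec, shiftedLift, -Nat.cast_add, -Nat.cast_mul, Padic.residue_natCast]
  simp

theorem norm_shiftedLift_le_one (x : (Fin n → ZMod p) × ℕ) : ‖shiftedLift x‖ ≤ 1 := by
  rw [pi_norm_le_iff_of_nonneg zero_le_one]
  intro i
  simpa only [PadicInt.norm_def, PadicInt.coe_natCast, shiftedLift] using
    PadicInt.norm_le_one (((x.1 i).val + p * x.2 : ℕ) : ℤ_[p])

theorem shiftedLift_injective (hn : 0 < n) :
    Function.Injective (shiftedLift : (Fin n → ZMod p) × ℕ → Fin n → ℚ_[p]) := by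
  rintro ⟨w, j⟩ ⟨w', j'⟩ h
  have hw : w = w' := by
    have := congrArg residueVec h
    rwa [residueVec_shiftedLift, residueVec_shiftedLift] at this
  subst hw
  have h0 := Nat.cast_injective (congrFun h ⟨0, hn⟩)
  have hp := (Fact.out : p.Prime).pos
  simp only [Nat.add_left_cancel_iff] at h0
  rw [Nat.eq_of_mul_eq_mul_left hp h0]

open Classical in
/-- The vectors lifting each nonzero vector of `𝔽_p^n` in `t` different ways. -/
noncomputable def liftedVectors (p n t : ℕ) [Fact p.Prime] : Finset (Fin n → ℚ_[p]) :=
  (({w : Fin n → ZMod p | w ≠ 0} : Finset _) ×ˢ range t).image shiftedLift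

theorem card_liftedVectors (hn : 0 < n) (t : ℕ) :
    #(liftedVectors p n t) = (p ^ n - 1) * t := by
  classical
  rw [liftedVectors, Finset.card_image_of_injective _ (shiftedLift_injective hn),
    Finset.card_product, card_filter_ne_zero_zmod, Finset.card_range]

/-- A set of lifted vectors whose reductions span a space of dimension at most `d` is small. -/
theorem card_le_of_subset_liftedVectors {t : ℕ} {E b : Finset (Fin n → ℚ_[p])}
    (hE : E ⊆ liftedVectors p n t)
    (hspan : residueVec '' (E : Set (Fin n → ℚ_[p])) ⊆
      Submodule.span (ZMod p) (residueVec '' (b : Set (Fin n → ℚ_[p])))) :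
    #E ≤ t * (p ^ #b - 1) := by
  classical
  have hmem {u} (hu : u ∈ E) : ∃ w, w ≠ 0 ∧ ∃ j < t, shiftedLift (w, j) = u := by
    have := hE hu
    simp only [liftedVectors, mem_image, mem_product, mem_filter, mem_univ, true_and, mem_range,
      Prod.exists] at this
    obtain ⟨w, j, ⟨hw, hj⟩, h⟩ := this
    exact ⟨w, hw, j, hj, h⟩
  refine (Finset.card_le_mul_card_image (f := residueVec) E t ?_).trans ?_
  · intro w _
    refine (Finset.card_le_card (t := (range t).image fun j => shiftedLift (w, j)) ?_).trans
      (Finset.card_image_le.trans (Finset.card_range t).le)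
    intro u hu
    obtain ⟨huE, rfl⟩ := Finset.mem_filter.1 hu
    obtain ⟨w, -, j, hj, rfl⟩ := hmem huE
    rw [residueVec_shiftedLift]
    exact Finset.mem_image.2 ⟨j, Finset.mem_range.2 hj, rfl⟩
  · refine Nat.mul_le_mul_left _ ?_
    set W := Submodule.span (ZMod p) (residueVec '' (b : Set (Fin n → ℚ_[p]))) with hW
    have hsub : E.image residueVec ⊆ ((W : Set (Fin n → ZMod p)).toFinset).erase 0 := by
      intro w hw
      obtain ⟨u, hu, rfl⟩ := Finset.mem_image.1 hw
      rw [Finset.mem_erase, Set.mem_toFinset]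
      refine ⟨?_, hspan ⟨u, hu, rfl⟩⟩
      obtain ⟨w, hw, j, -, rfl⟩ := hmem hu
      rwa [residueVec_shiftedLift]
    refine (Finset.card_le_card hsub).trans ?_
    rw [Finset.card_erase_of_mem (by simp), Set.toFinset_card]
    have hcard : Fintype.card W = p ^ Module.finrank (ZMod p) W := by
      rw [Module.card_eq_pow_finrank (K := ZMod p), ZMod.card]
    have hrank : Module.finrank (ZMod p) W ≤ #b := by
      rw [hW, ← Finset.coe_image]
      exact (finrank_span_finset_le_card _).trans Finset.card_image_le
    have := Nat.pow_le_pow_right (Fact.out : p.Prime).pos hrank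
    rw [← hcard] at this
    exact Nat.sub_le_sub_right this 1

theorem orthKL_liftedVectors {ℓ : ℕ} (hℓ : 1 ≤ ℓ) (t : ℕ) :
    OrthKL p (t * (p ^ (ℓ - 1) - 1) + 1) ℓ (liftedVectors p n t) := by
  classical
  have hmem {u} (hu : u ∈ liftedVectors p n t) :
      ∃ x : (Fin n → ZMod p) × ℕ, x.1 ≠ 0 ∧ shiftedLift x = u := by
    obtain ⟨x, hx, rfl⟩ := Finset.mem_image.1 hu
    exact ⟨x, by simpa using (Finset.mem_product.1 hx).1, rfl⟩
  refine ⟨fun h0 => ?_, fun E hE hcard => ?_⟩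
  · obtain ⟨x, hx, h⟩ := hmem h0
    apply hx
    rw [← residueVec_shiftedLift x, h]
    ext i
    simpa [residueVec] using Padic.residue_natCast (p := p) 0
  · obtain ⟨b, hbE, -, hspan, hli⟩ := exists_linearIndepOn_extension (K := ZMod p)
      (v := residueVec) (linearIndepOn_empty _ _) (Set.empty_subset (E : Set (Fin n → ℚ_[p])))
    lift b to Finset (Fin n → ℚ_[p]) using E.finite_toSet.subset hbE
    have hb : ℓ ≤ #b := by
      by_contra! hlt
      have h1 := card_le_of_subset_liftedVectors hE hspan
      have h2 : t * (p ^ #b - 1) ≤ t * (p ^ (ℓ - 1) - 1) :=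
        Nat.mul_le_mul_left _ (Nat.sub_le_sub_right
          (Nat.pow_le_pow_right (Fact.out : p.Prime).pos (by omega)) 1)
      omega
    obtain ⟨F, hFb, hF⟩ := Finset.exists_subset_card_eq hb
    have hFE : F ⊆ E := hFb.trans (Finset.coe_subset.1 hbE)
    refine ⟨F, hFE, hF, orthSet_of_linearIndepOn (fun u hu => ?_)
      (hli.mono (Finset.coe_subset.2 hFb))⟩
    obtain ⟨x, -, rfl⟩ := hmem (hE (hFE hu))
    exact norm_shiftedLift_le_one x

end Reduction

theorem tendsto_mul_div_mul_add_one (a : ℝ) {b : ℝ} (hb : b ≠ 0) :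
    Filter.Tendsto (fun t : ℕ => a * t / (t * b + 1)) Filter.atTop (nhds (a / b)) := by
  have h : Filter.Tendsto (fun t : ℕ => a / (b + (t : ℝ)⁻¹)) Filter.atTop (nhds (a / (b + 0))) :=
    tendsto_const_nhds.div (tendsto_const_nhds.add tendsto_inv_atTop_nhds_zero_nat) (by simpa)
  rw [add_zero] at h
  refine h.congr' ?_
  filter_upwards [Filter.eventually_gt_atTop 0] with t ht
  have ht' : (t : ℝ) ≠ 0 := by positivity
  rw [← mul_div_mul_right a _ ht', add_mul, inv_mul_cancel₀ ht', mul_comm b]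

theorem stmt8 (p : ℕ) [Fact p.Prime] (n ℓ : ℕ) (hℓ : 2 ≤ ℓ) (hℓn : ℓ ≤ n) :
    ((p : ℝ) ^ n - 1) / ((p : ℝ) ^ (ℓ - 1) - 1) ≤
      Filter.limsup (fun k : ℕ => (Theta p n k ℓ : ℝ) / (k : ℝ)) Filter.atTop ∧
    Filter.limsup (fun k : ℕ => (Theta p n k ℓ : ℝ) / (k : ℝ)) Filter.atTop ≤
      (p : ℝ) ^ n - 1 := by
  have hp : 1 < p := (Fact.out : p.Prime).one_lt
  have hcast (m : ℕ) : ((p ^ m - 1 : ℕ) : ℝ) = (p : ℝ) ^ m - 1 := by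
    rw [Nat.cast_sub (Nat.one_le_pow _ _ (by omega))]
    simp
  have hupper : ∀ᶠ k : ℕ in Filter.atTop, (Theta p n k ℓ : ℝ) / (k : ℝ) ≤ (p : ℝ) ^ n - 1 := by
    filter_upwards [Filter.eventually_gt_atTop 0] with k hk
    rw [div_le_iff₀ (by exact_mod_cast hk), ← hcast, mul_comm]
    exact_mod_cast Theta_le hℓ
  have hlower : ∀ k : ℕ, 0 ≤ (Theta p n k ℓ : ℝ) / (k : ℝ) := fun k => by positivity
  refine ⟨le_of_forall_lt_imp_le_of_dense fun c hc => ?_, Filter.limsup_le_of_le ?_ hupper⟩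
  · obtain ⟨m, rfl⟩ : ∃ m, ℓ = m + 2 := ⟨ℓ - 2, by omega⟩
    have hb : (p : ℝ) ^ (m + 2 - 1) - 1 ≠ 0 := by
      have : (1 : ℝ) < p := by exact_mod_cast hp
      exact (sub_pos.2 (one_lt_pow₀ this (by omega))).ne'
    have hk : Filter.Tendsto (fun t : ℕ => t * (p ^ (m + 2 - 1) - 1) + 1)
        Filter.atTop Filter.atTop := by
      refine Filter.tendsto_atTop_mono (fun t => ?_) Filter.tendsto_id
      have : 1 ≤ p ^ (m + 2 - 1) - 1 := Nat.le_sub_one_of_lt (Nat.one_lt_pow (by omega) hp)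
      exact (Nat.le_mul_of_pos_right t this).trans (Nat.le_succ _)
    have hev := (tendsto_mul_div_mul_add_one ((p : ℝ) ^ n - 1) hb).eventually_const_lt hc
    refine Filter.le_limsup_of_frequently_le (hk.frequently ?_) ⟨_, hupper⟩
    refine (hev.mono fun t ht => ht.le.trans ?_).frequently
    have hle := (orthKL_liftedVectors (p := p) (n := n) (ℓ := m + 2) (by omega) t).card_le_Theta hℓ
    rw [card_liftedVectors (by omega)] at hle
    have hle' : ((p : ℝ) ^ n - 1) * t ≤
        Theta p n (t * (p ^ (m + 2 - 1) - 1) + 1) (m + 2) := by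
      rw [← hcast]
      exact_mod_cast hle
    rw [Nat.cast_add, Nat.cast_mul, hcast, Nat.cast_one]
    rw [← hcast (m + 2 - 1)]
    gcongr
  · exact Filter.isCoboundedUnder_le_of_le _ hlower
end

section
/- Let q be a prime power, 𝔽_q a finite field with q elements, and 2 ≤ ℓ ≤ k ≤ (q^n−1)/(q−1) with ℓ ≤ n. Then ⌈Ind_q(n,k,ℓ)/(q−1)⌉ ≤ Ind_q^{pro}(n,k,ℓ) ≤ ⌊Ind_q(n,(q−1)k,ℓ)/(q−1)⌋. -/
open Finset

/-- A finite set `S ⊆ F^n \ {0}` is `(k,ℓ)`-independent if every subset `X ⊆ S` of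
size `k` spans a subspace of dimension at least `ℓ`. -/
def IndKL (F : Type*) [Field F] (n k ℓ : ℕ) (S : Finset (Fin n → F)) : Prop :=
  (0 : Fin n → F) ∉ S ∧
    ∀ X ⊆ S, X.card = k →
      ℓ ≤ Module.finrank F ↥(Submodule.span F (↑X : Set (Fin n → F)))

/-- `Ind_q(n,k,ℓ)`: the maximum size of a `(k,ℓ)`-independent subset of
`F^n \ {0}`, where `F` is a field (with `q` elements). -/
noncomputable def IndMax (F : Type*) [Field F] (n k ℓ : ℕ) : ℕ :=
  sSup {m | ∃ S : Finset (Fin n → F), IndKL F n k ℓ S ∧ S.card = m}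

/-- A finite set `S` of points of the projective space `ℙ^{n-1}(F)` is
`(k,ℓ)`-pro-independent if every subset `X ⊆ S` of size `k` spans (as the span of
representative lines) a subspace of dimension at least `ℓ`. -/
def ProIndKL (F : Type*) [Field F] (n k ℓ : ℕ)
    (S : Finset (Projectivization F (Fin n → F))) : Prop :=
  ∀ X ⊆ S, X.card = k →
    ℓ ≤ Module.finrank F ↥(X.sup fun x => Projectivization.submodule x)

/-- `Ind_q^{pro}(n,k,ℓ)`: the maximum size of a `(k,ℓ)`-pro-independent subset of
`ℙ^{n-1}(F)`, where `F` is a field (with `q` elements). -/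
noncomputable def ProIndMax (F : Type*) [Field F] (n k ℓ : ℕ) : ℕ :=
  sSup {m | ∃ S : Finset (Projectivization F (Fin n → F)),
    ProIndKL F n k ℓ S ∧ S.card = m}

section Fibers

variable {F V : Type*} [Field F] [AddCommGroup V] [Module F V]

open Classical in
theorem Projectivization.card_filter_mk'_eq [Fintype F] [Fintype V] (p : Projectivization F V) :
    #{v : {v : V // v ≠ 0} | Projectivization.mk' F v = p} = Fintype.card F - 1 := by
  induction p using Projectivization.ind with
  | h w hw =>
    rw [← Fintype.card_units, ← Finset.card_univ]
    symm
    refine Finset.card_bij (fun a _ => ⟨a • w, (smul_ne_zero_iff_ne a).2 hw⟩) ?_ ?_ ?_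
    · intro a _
      exact mem_filter.2 ⟨mem_univ _, (Projectivization.mk_eq_mk_iff F _ _ _ hw).2 ⟨a, rfl⟩⟩
    · intro a _ b _ h
      have h' : (a : F) • w = (b : F) • w := congrArg Subtype.val h
      exact Units.ext (smul_left_injective F hw h')
    · rintro ⟨v, hv⟩ h
      obtain ⟨a, ha⟩ := (Projectivization.mk_eq_mk_iff F _ _ hv hw).1 (mem_filter.1 h).2
      exact ⟨a, mem_univ _, Subtype.ext ha⟩

open Classical in
theorem Projectivization.card_le_mul_card_image_mk' [Fintype F] [Finite V]
    (U : Finset {v : V // v ≠ 0}) :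
    #U ≤ (Fintype.card F - 1) * #(U.image (Projectivization.mk' F)) := by
  have := Fintype.ofFinite V
  refine Finset.card_le_mul_card_image U _ fun p _ => ?_
  rw [← Projectivization.card_filter_mk'_eq p]
  exact card_le_card (filter_subset_filter _ (subset_univ U))

open Classical in
theorem Projectivization.sup_submodule_image_mk' (U : Finset {v : V // v ≠ 0}) :
    (U.image (Projectivization.mk' F)).sup (fun x => Projectivization.submodule x) =
      Submodule.span F (↑(U.map (Function.Embedding.subtype _)) : Set V) := by
  induction U using Finset.induction_on with
  | empty => simp
  | insert v U _ ih =>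
    rw [image_insert, sup_insert, ih, map_insert, coe_insert, Submodule.span_insert,
      Projectivization.mk'_eq_mk, Projectivization.submodule_mk]
    rfl

end Fibers

section Independence

variable {F : Type*} [Field F] {n k ℓ : ℕ}

open Classical in
theorem IndKL.proIndKL_image_mk' {U : Finset {v : Fin n → F // v ≠ 0}}
    (hU : IndKL F n k ℓ (U.map (Function.Embedding.subtype _))) :
    ProIndKL F n k ℓ (U.image (Projectivization.mk' F)) := by
  intro X hX hXk
  obtain ⟨W, hWU, hinj, hWX⟩ := exists_subset_injOn_image_eq_of_surjOn
    (f := Projectivization.mk' F) (U : Set {v : Fin n → F // v ≠ 0}) X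
    fun p hp => mem_image.1 (hX hp)
  rw [← hWX, Projectivization.sup_submodule_image_mk']
  refine hU.2 _ (map_subset_map.2 (coe_subset.1 hWU)) ?_
  rw [card_map, ← hXk, ← hWX, card_image_of_injOn hinj]

variable [Fintype F]

theorem IndKL.card_le_indMax {S : Finset (Fin n → F)} (hS : IndKL F n k ℓ S) :
    #S ≤ IndMax F n k ℓ := by
  refine le_csSup ⟨Fintype.card (Fin n → F), ?_⟩ ⟨S, hS, rfl⟩
  rintro _ ⟨T, -, rfl⟩
  exact card_le_univ T

theorem ProIndKL.card_le_proIndMax {S : Finset (Projectivization F (Fin n → F))}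
    (hS : ProIndKL F n k ℓ S) : #S ≤ ProIndMax F n k ℓ := by
  have := Fintype.ofFinite (Projectivization F (Fin n → F))
  refine le_csSup ⟨Fintype.card (Projectivization F (Fin n → F)), ?_⟩ ⟨S, hS, rfl⟩
  rintro _ ⟨T, -, rfl⟩
  exact card_le_univ T

open Classical in
theorem ProIndKL.indKL_preimage_mk' {S : Finset (Projectivization F (Fin n → F))}
    (hS : ProIndKL F n k ℓ S) :
    IndKL F n ((Fintype.card F - 1) * k) ℓ
      (Finset.map (Function.Embedding.subtype _)
        ({v | Projectivization.mk' F v ∈ S} : Finset {v : Fin n → F // v ≠ 0})) := by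
  refine ⟨by simp, fun X hX hXk => ?_⟩
  obtain ⟨U, hU, rfl⟩ := subset_map_iff.1 hX
  rw [card_map] at hXk
  have hq : 0 < Fintype.card F - 1 := Nat.sub_pos_of_lt Fintype.one_lt_card
  have hk : k ≤ #(U.image (Projectivization.mk' F)) :=
    Nat.le_of_mul_le_mul_left (hXk ▸ Projectivization.card_le_mul_card_image_mk' U) hq
  obtain ⟨Y, hYU, hYk⟩ := exists_subset_card_eq hk
  have hUS : U.image (Projectivization.mk' F) ⊆ S :=
    image_subset_iff.2 fun v hv => (mem_filter.1 (hU hv)).2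
  rw [← Projectivization.sup_submodule_image_mk']
  exact (hS Y (hYU.trans hUS) hYk).trans (Submodule.finrank_mono (sup_mono hYU))

theorem indMax_le_mul_proIndMax :
    IndMax F n k ℓ ≤ (Fintype.card F - 1) * ProIndMax F n k ℓ := by
  classical
  refine csSup_le' ?_
  rintro _ ⟨S, hS, rfl⟩
  have hmap : (S.subtype (· ≠ 0)).map (Function.Embedding.subtype _) = S :=
    subtype_map_of_mem fun v hv h => hS.1 (h ▸ hv)
  rw [← hmap] at hS ⊢
  rw [card_map]
  exact (Projectivization.card_le_mul_card_image_mk' _).trans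
    (Nat.mul_le_mul_left _ hS.proIndKL_image_mk'.card_le_proIndMax)

theorem proIndMax_mul_le_indMax :
    ProIndMax F n k ℓ * (Fintype.card F - 1) ≤ IndMax F n ((Fintype.card F - 1) * k) ℓ := by
  classical
  have hq : 0 < Fintype.card F - 1 := Nat.sub_pos_of_lt Fintype.one_lt_card
  rw [← Nat.le_div_iff_mul_le hq]
  refine csSup_le' ?_
  rintro _ ⟨S, hS, rfl⟩
  rw [Nat.le_div_iff_mul_le hq]
  refine le_trans (le_of_eq ?_) hS.indKL_preimage_mk'.card_le_indMax
  rw [card_map, card_eq_sum_card_fiberwise (f := Projectivization.mk' F)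
    (s := {v | Projectivization.mk' F v ∈ S}) (t := S)
    fun v hv => (mem_filter.1 (mem_coe.1 hv)).2, ← smul_eq_mul, ← sum_const]
  refine sum_congr rfl fun p hp => ?_
  rw [← Projectivization.card_filter_mk'_eq p, filter_filter]
  congr 1
  ext v
  simp only [mem_filter, mem_univ, true_and]
  exact ⟨fun h => ⟨h ▸ hp, h⟩, And.right⟩

end Independence

theorem stmt18 (q : ℕ) (hq : IsPrimePow q) (F : Type*) [Field F] [Fintype F]
    (hF : Fintype.card F = q) (n k ℓ : ℕ)
    (hℓ : 2 ≤ ℓ) (hℓk : ℓ ≤ k) (hk : k ≤ (q ^ n - 1) / (q - 1)) (hℓn : ℓ ≤ n) :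
    IndMax F n k ℓ ⌈/⌉ (q - 1) ≤ ProIndMax F n k ℓ ∧
    ProIndMax F n k ℓ ≤ IndMax F n ((q - 1) * k) ℓ / (q - 1) := by
  subst hF
  have hq' : 0 < Fintype.card F - 1 := Nat.sub_pos_of_lt Fintype.one_lt_card
  exact ⟨(ceilDiv_le_iff_le_mul hq').2 indMax_le_mul_proIndMax,
    (Nat.le_div_iff_mul_le hq').2 proIndMax_mul_le_indMax⟩
end
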